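/- arXiv:1304.1931 — 10 statements merged into one kernel-verified Lean document; each statement's English description precedes it below -/
import Mathlib

section
/- Let c : ℝ → ℝ be positive and twice continuously differentiable, and let (r, z) : I → ℝ² be a twice-differentiable curve satisfying the ray equations r̈ = 2(c'(z)/c(z))·ṙ·ż and z̈ = −(c'(z)/c(z))·(ṙ² − ż²). Then the Snell invariant t ↦ ṙ(t)/c(z(t))² is constant on I; in particular, if ṙ(0) = c(z(0))·cos θ₀ and ż(0) = −c(z(0))·sin θ₀, then ṙ(t)/c(z(t))² = cos θ₀ / c(z(0)) for all t in I. -/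
/-- The horizontal ray equation makes the derivative of `ṙ/c(z)²` vanish. -/
theorem hasDerivAt_snell_invariant {c r z : ℝ → ℝ} {t : ℝ} (hct : c (z t) ≠ 0)
    (hc : DifferentiableAt ℝ c (z t)) (hr : DifferentiableAt ℝ (deriv r) t)
    (hz : DifferentiableAt ℝ z t)
    (hray : deriv (deriv r) t = 2 * (deriv c (z t) / c (z t)) * deriv r t * deriv z t) :
    HasDerivAt (fun s => deriv r s / (c (z s)) ^ 2) 0 t := by
  have hcz : HasDerivAt (fun s => c (z s)) (deriv c (z t) * deriv z t) t :=
    hc.hasDerivAt.comp t hz.hasDerivAt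
  refine (hr.hasDerivAt.fun_div (hcz.fun_pow 2) (pow_ne_zero 2 hct)).congr_deriv ?_
  rw [hray]
  field_simp
  norm_num


/-- Along a ray the Snell invariant `ṙ/c(z)²` is constant; in
particular, with initial conditions `ṙ(0) = c(z(0))·cos θ₀`,
`ż(0) = −c(z(0))·sin θ₀`, it equals `cos θ₀ / c(z(0))` on all of `I`. -/
theorem snell_invariant_constant
    (c : ℝ → ℝ) (hcpos : ∀ x, 0 < c x) (hc : ContDiff ℝ 2 c)
    (I : Set ℝ) (hI : Convex ℝ I) (h0 : (0 : ℝ) ∈ I)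
    (r z : ℝ → ℝ) (θ₀ : ℝ)
    (hr1 : ∀ t ∈ I, DifferentiableAt ℝ r t)
    (hr2 : ∀ t ∈ I, DifferentiableAt ℝ (deriv r) t)
    (hz1 : ∀ t ∈ I, DifferentiableAt ℝ z t)
    (hz2 : ∀ t ∈ I, DifferentiableAt ℝ (deriv z) t)
    (hrayr : ∀ t ∈ I, deriv (deriv r) t =
      2 * (deriv c (z t) / c (z t)) * deriv r t * deriv z t)
    (hrayz : ∀ t ∈ I, deriv (deriv z) t =
      -(deriv c (z t) / c (z t)) * ((deriv r t) ^ 2 - (deriv z t) ^ 2)) :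
    (∀ t₁ ∈ I, ∀ t₂ ∈ I,
      deriv r t₁ / (c (z t₁)) ^ 2 = deriv r t₂ / (c (z t₂)) ^ 2) ∧
    (deriv r 0 = c (z 0) * Real.cos θ₀ →
     deriv z 0 = -(c (z 0) * Real.sin θ₀) →
     ∀ t ∈ I, deriv r t / (c (z t)) ^ 2 = Real.cos θ₀ / c (z 0)) := by
  have hconst : ∀ t₁ ∈ I, ∀ t₂ ∈ I,
      deriv r t₁ / (c (z t₁)) ^ 2 = deriv r t₂ / (c (z t₂)) ^ 2 := by
    intro t₁ h₁ t₂ h₂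
    have hderiv : ∀ t ∈ I, HasDerivWithinAt (fun s => deriv r s / (c (z s)) ^ 2) 0 I t :=
      fun t ht => (hasDerivAt_snell_invariant (hcpos (z t)).ne'
        (hc.differentiable two_ne_zero (z t)) (hr2 t ht) (hz1 t ht)
        (hrayr t ht)).hasDerivWithinAt
    have hle := hI.norm_image_sub_le_of_norm_hasDerivWithin_le (C := 0) hderiv
      (fun _ _ => norm_zero.le) h₂ h₁
    rw [zero_mul, norm_le_zero_iff] at hle
    exact sub_eq_zero.mp hle
  refine ⟨hconst, fun hr0 _ t ht => ?_⟩
  rw [hconst t ht 0 h0, hr0]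
  have := (hcpos (z 0)).ne'
  field_simp
end

section
/- Let c(z) = c₀ + γ·z with γ ≠ 0 be a linear SSP, and let (r, z) : I → ℝ² (with 0 ∈ I) be a twice-differentiable curve satisfying the ray equations r̈ = 2(c'(z)/c(z))·ṙ·ż and z̈ = −(c'(z)/c(z))·(ṙ² − ż²) with c(z(t)) > 0 on I, initial conditions r(0) = 0, z(0) = z₀, ṙ(0) = c(z₀)·cos θ₀, ż(0) = −c(z₀)·sin θ₀, and cos θ₀ ≠ 0. Then the curve lies on a circle: for all t in I, (r(t) + c(z₀)·tan θ₀/γ)² + (z(t) + c₀/γ)² = c(z₀)²·sec²θ₀/γ². -/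
/-- A real function whose derivative vanishes at every point of a convex set is constant there. -/
theorem Convex.eq_of_hasDerivAt_zero {f : ℝ → ℝ} {s : Set ℝ} (hs : Convex ℝ s)
    (hf : ∀ x ∈ s, HasDerivAt f 0 x) {x y : ℝ} (hx : x ∈ s) (hy : y ∈ s) : f y = f x := by
  have h := hs.norm_image_sub_le_of_norm_hasDerivWithin_le (f := f) (f' := fun _ => 0) (C := 0)
    (fun t ht => (hf t ht).hasDerivWithinAt) (by simp) hx hy
  rw [zero_mul, norm_le_zero_iff, sub_eq_zero] at h
  exact h

/-- For a linear sound speed profile `c(z) = c₀ + γ·z` with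
`γ ≠ 0`, a ray launched from `(0, z₀)` with elevation angle `θ₀`
(`cos θ₀ ≠ 0`) lies on the circle
`(r + c(z₀)·tan θ₀/γ)² + (z + c₀/γ)² = c(z₀)²·sec²θ₀/γ²`. -/
theorem linear_ssp_rays_are_circles
    (c₀ γ z₀ θ₀ : ℝ) (hγ : γ ≠ 0)
    (c : ℝ → ℝ) (hc : ∀ x, c x = c₀ + γ * x)
    (I : Set ℝ) (hI : Convex ℝ I) (h0 : (0 : ℝ) ∈ I)
    (r z : ℝ → ℝ)
    (hr1 : ∀ t ∈ I, DifferentiableAt ℝ r t)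
    (hr2 : ∀ t ∈ I, DifferentiableAt ℝ (deriv r) t)
    (hz1 : ∀ t ∈ I, DifferentiableAt ℝ z t)
    (hz2 : ∀ t ∈ I, DifferentiableAt ℝ (deriv z) t)
    (hcpos : ∀ t ∈ I, 0 < c (z t))
    (hrayr : ∀ t ∈ I, deriv (deriv r) t =
      2 * (deriv c (z t) / c (z t)) * deriv r t * deriv z t)
    (hrayz : ∀ t ∈ I, deriv (deriv z) t =
      -(deriv c (z t) / c (z t)) * ((deriv r t) ^ 2 - (deriv z t) ^ 2))
    (hr0 : r 0 = 0) (hz0 : z 0 = z₀)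
    (hr'0 : deriv r 0 = c z₀ * Real.cos θ₀)
    (hz'0 : deriv z 0 = -(c z₀ * Real.sin θ₀))
    (hθ : Real.cos θ₀ ≠ 0) :
    ∀ t ∈ I,
      (r t + c z₀ * Real.tan θ₀ / γ) ^ 2 + (z t + c₀ / γ) ^ 2 =
        (c z₀) ^ 2 * (1 / Real.cos θ₀) ^ 2 / γ ^ 2 := by
  have hcd : ∀ x, HasDerivAt c γ x := fun x => by
    rw [funext hc]
    simpa using ((hasDerivAt_id x).const_mul γ).const_add c₀
  have hcz : ∀ t ∈ I, HasDerivAt (fun t => c (z t)) (γ * deriv z t) t := fun t ht =>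
    (hcd (z t)).comp t (hz1 t ht).hasDerivAt
  have hrr : ∀ t ∈ I, HasDerivAt (deriv r) (2 * (γ / c (z t)) * deriv r t * deriv z t) t :=
    fun t ht => by
      have h := (hr2 t ht).hasDerivAt
      rwa [hrayr t ht, (hcd _).deriv] at h
  have hzz : ∀ t ∈ I,
      HasDerivAt (deriv z) (-(γ / c (z t)) * ((deriv r t) ^ 2 - (deriv z t) ^ 2)) t :=
    fun t ht => by
      have h := (hz2 t ht).hasDerivAt
      rwa [hrayz t ht, (hcd _).deriv] at h
  have hc0 : c z₀ ≠ 0 := hz0 ▸ (hcpos 0 h0).ne'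
  have snell : ∀ t ∈ I, deriv r t / c (z t) ^ 2 = Real.cos θ₀ / c z₀ := fun t ht => by
    have h := hI.eq_of_hasDerivAt_zero (f := fun t => deriv r t / c (z t) ^ 2)
      (fun x hx => by
        have hne := (hcpos x hx).ne'
        refine ((hrr x hx).div ((hcz x hx).pow 2) (pow_ne_zero 2 hne)).congr_deriv ?_
        simp only [Pi.pow_apply]
        field_simp
        push_cast
        ring) h0 ht
    simp only [hz0, hr'0] at h
    rw [h]
    field_simp
  have speed : ∀ t ∈ I, (deriv r t ^ 2 + deriv z t ^ 2) / c (z t) ^ 2 = 1 := fun t ht => by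
    have h := hI.eq_of_hasDerivAt_zero
      (f := fun t => (deriv r t ^ 2 + deriv z t ^ 2) / c (z t) ^ 2)
      (fun x hx => by
        have hne := (hcpos x hx).ne'
        refine ((((hrr x hx).pow 2).add ((hzz x hx).pow 2)).div ((hcz x hx).pow 2)
          (pow_ne_zero 2 hne)).congr_deriv ?_
        simp only [Pi.pow_apply, Pi.add_apply]
        field_simp
        push_cast
        ring) h0 ht
    simp only [hz0, hr'0, hz'0] at h
    rw [h, div_eq_one_iff_eq (pow_ne_zero 2 hc0)]
    linear_combination c z₀ ^ 2 * Real.sin_sq_add_cos_sq θ₀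
  have slope : ∀ t ∈ I,
      deriv z t / c (z t) + γ * (Real.cos θ₀ / c z₀) * r t = -Real.sin θ₀ := fun t ht => by
    have h := hI.eq_of_hasDerivAt_zero
      (f := fun t => deriv z t / c (z t) + γ * (Real.cos θ₀ / c z₀) * r t)
      (fun x hx => by
        have hne := (hcpos x hx).ne'
        refine (((hzz x hx).div (hcz x hx) hne).add
          ((hr1 x hx).hasDerivAt.const_mul (γ * (Real.cos θ₀ / c z₀)))).congr_deriv ?_
        rw [← snell x hx]
        field_simp
        ring) h0 ht
    simp only [hz0, hr0, hz'0] at h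
    rw [h]
    field_simp
    ring
  intro t ht
  have hne := (hcpos t ht).ne'
  have h1 : deriv r t = Real.cos θ₀ / c z₀ * c (z t) ^ 2 :=
    (div_eq_iff (pow_ne_zero 2 hne)).1 (snell t ht)
  have h2 : deriv z t = (-Real.sin θ₀ - γ * (Real.cos θ₀ / c z₀) * r t) * c (z t) :=
    (div_eq_iff hne).1 (by linear_combination slope t ht)
  have key : (Real.cos θ₀ / c z₀ * c (z t)) ^ 2 +
      (Real.sin θ₀ + γ * (Real.cos θ₀ / c z₀) * r t) ^ 2 = 1 := by
    rw [← speed t ht, h1, h2]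
    field_simp
    ring
  have hz : z t + c₀ / γ = c (z t) / γ := by
    rw [hc]
    field_simp
    ring
  rw [hz, Real.tan_eq_sin_div_cos]
  field_simp at key ⊢
  linear_combination key
end

section
/- Let c : ℝ → ℝ be positive and twice continuously differentiable. Let (r, z) : I → ℝ² be a curve parameterized by arclength s (so r'(s)² + z'(s)² = 1) satisfying the Frenet–Serret ray equations r'' = (c'(z)/c(z))·r'·z' and z'' = −(c'(z)/c(z))·(r')². Let δq, δp : I → ℝ satisfy the extrinsic paraxial ray equations dδq/ds = c(z)·δp and dδp/ds = −(c''(z)·(r')²/c(z)²)·δq. Let t(s) = ∫₀^s c(z(σ))^{−1} dσ with inverse s(t), and define the intrinsic variable δq̃(t) = δq(s(t))/c(z(s(t))). Then δq̃ is twice differentiable and satisfies the intrinsic second-order paraxial ray equation d²δq̃/dt² + (c·c'' − (c')²)(z(s(t)))·δq̃ = 0. -/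
open Filter Topology in
/-- If `σ` is a left inverse of `τ x = ∫₀ˣ f` near `s`, where `f` is continuous near the segment from
`0` to `s` and `f s ≠ 0`, then `σ` has strict derivative `(f s)⁻¹` at `τ s`, and `τ` maps
neighbourhoods of `s` onto neighbourhoods of `τ s`. -/
lemma hasStrictDerivAt_leftInverse_of_integral {f τ σ : ℝ → ℝ} {I : Set ℝ} (hI : IsOpen I)
    (hconv : Convex ℝ I) (h0 : (0 : ℝ) ∈ I) (hf : ContinuousOn f I)
    (hτ : ∀ s, τ s = ∫ x in (0 : ℝ)..s, f x) (hσ : ∀ s ∈ I, σ (τ s) = s)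
    {s : ℝ} (hs : s ∈ I) (hfs : f s ≠ 0) :
    HasStrictDerivAt σ (f s)⁻¹ (τ s) ∧ map τ (𝓝 s) = 𝓝 (τ s) := by
  obtain rfl : τ = fun s => ∫ x in (0 : ℝ)..s, f x := funext hτ
  have hsub : Set.uIcc 0 s ⊆ I := hconv.ordConnected.uIcc_subset h0 hs
  have hd : HasStrictDerivAt (fun s => ∫ x in (0 : ℝ)..s, f x) (f s) s :=
    intervalIntegral.integral_hasStrictDerivAt_right (hf.mono hsub).intervalIntegrable
      (hf.stronglyMeasurableAtFilter hI s hs) (hf.continuousAt (hI.mem_nhds hs))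
  refine ⟨hd.to_local_left_inverse hfs ?_, hd.map_nhds_eq hfs⟩
  filter_upwards [hI.mem_nhds hs] with x hx using hσ x hx

/-- For a ray parameterized by arclength satisfying the
Frenet–Serret ray equations, with paraxial variables `δq, δp` satisfying the
extrinsic Červený equations, the intrinsic variable `δq̃(t) = δq(s(t))/c(z(s(t)))`
(with `t(s) = ∫₀ˢ c(z(σ))⁻¹ dσ` and inverse `s(t)`) is twice differentiable and
satisfies `d²δq̃/dt² + (c·c'' − (c')²)(z(s(t)))·δq̃ = 0`. -/
theorem paraxial_intrinsic_second_order
    (c : ℝ → ℝ) (hcpos : ∀ x, 0 < c x) (hc : ContDiff ℝ 2 c)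
    (I : Set ℝ) (hIopen : IsOpen I) (hIconv : Convex ℝ I) (h0 : (0 : ℝ) ∈ I)
    (r z r' z' : ℝ → ℝ)
    (hr : ∀ s ∈ I, HasDerivAt r (r' s) s)
    (hz : ∀ s ∈ I, HasDerivAt z (z' s) s)
    (hunit : ∀ s ∈ I, (r' s) ^ 2 + (z' s) ^ 2 = 1)
    (hfsr : ∀ s ∈ I, HasDerivAt r' (deriv c (z s) / c (z s) * r' s * z' s) s)
    (hfsz : ∀ s ∈ I, HasDerivAt z' (-(deriv c (z s) / c (z s)) * (r' s) ^ 2) s)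
    (δq δp : ℝ → ℝ)
    (hδq : ∀ s ∈ I, HasDerivAt δq (c (z s) * δp s) s)
    (hδp : ∀ s ∈ I, HasDerivAt δp
      (-(deriv (deriv c) (z s) * (r' s) ^ 2 / (c (z s)) ^ 2) * δq s) s)
    (τ σ : ℝ → ℝ)
    (hτ : ∀ s, τ s = ∫ x in (0 : ℝ)..s, (c (z x))⁻¹)
    (hσ : ∀ s ∈ I, σ (τ s) = s)
    (δqt : ℝ → ℝ)
    (hδqt : ∀ t, δqt t = δq (σ t) / c (z (σ t))) :
    ∀ s ∈ I,
      DifferentiableAt ℝ δqt (τ s) ∧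
      DifferentiableAt ℝ (deriv δqt) (τ s) ∧
      deriv (deriv δqt) (τ s) +
        (c (z s) * deriv (deriv c) (z s) - (deriv c (z s)) ^ 2) * δqt (τ s) = 0 := by
  have hc1 : ∀ x, HasDerivAt c (deriv c x) x := fun x =>
    (hc.differentiable (by norm_num) x).hasDerivAt
  have hc2 : ∀ x, HasDerivAt (deriv c) (deriv (deriv c) x) x := fun x =>
    (((contDiff_succ_iff_deriv (n := 1)).1 hc).2.2.differentiable (by norm_num) x).hasDerivAt
  have hne : ∀ x, c x ≠ 0 := fun x => (hcpos x).ne'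
  have hcz : ∀ s ∈ I, HasDerivAt (fun x => c (z x)) (deriv c (z s) * z' s) s := fun s hs =>
    (hc1 (z s)).comp s (hz s hs)
  have hcz' : ∀ s ∈ I,
      HasDerivAt (fun x => deriv c (z x)) (deriv (deriv c) (z s) * z' s) s := fun s hs =>
    (hc2 (z s)).comp s (hz s hs)
  have hslow : ContinuousOn (fun x => (c (z x))⁻¹) I := fun s hs =>
    ((hcz s hs).continuousAt.inv₀ (hne _)).continuousWithinAt
  have hinv := fun s (hs : s ∈ I) => hasStrictDerivAt_leftInverse_of_integral hIopen hIconv h0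
    hslow hτ hσ hs (inv_ne_zero (hne (z s)))
  have hchain : ∀ (F : ℝ → ℝ) (F' s : ℝ), s ∈ I → HasDerivAt F F' s →
      HasDerivAt (fun t => F (σ t)) (F' * c (z s)) (τ s) := by
    intro F F' s hs hF
    have h := (hinv s hs).1.hasDerivAt
    rw [inv_inv] at h
    exact HasDerivAt.comp (τ s) (by rwa [hσ s hs]) h
  obtain rfl : δqt = fun t => δq (σ t) / c (z (σ t)) := funext hδqt
  let G : ℝ → ℝ := fun s => c (z s) * δp s - δq s * (deriv c (z s) * z' s) / c (z s)
  have hfirst : ∀ s ∈ I,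
      HasDerivAt (fun t => δq (σ t) / c (z (σ t))) (G s) (τ s) := by
    intro s hs
    convert hchain (fun x => δq x / c (z x)) _ s hs ((hδq s hs).div (hcz s hs) (hne _)) using 1
    have := hne (z s)
    simp only [G]
    field_simp
  have hG : ∀ s ∈ I, HasDerivAt G
      (-(c (z s) * deriv (deriv c) (z s) - deriv c (z s) ^ 2) * δq s / c (z s) ^ 2) s := by
    intro s hs
    refine (((hcz s hs).mul (hδp s hs)).sub
      (((hδq s hs).mul ((hcz' s hs).mul (hfsz s hs))).div (hcz s hs) (hne _))).congr_deriv ?_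
    have := hne (z s)
    have hr2 : r' s ^ 2 = 1 - z' s ^ 2 := by linarith [hunit s hs]
    simp only [Pi.mul_apply, hr2]
    field_simp
    ring
  intro s hs
  have hderiv : deriv (fun t => δq (σ t) / c (z (σ t))) =ᶠ[nhds (τ s)] fun t => G (σ t) := by
    rw [← (hinv s hs).2]
    refine Filter.eventually_map.2 ?_
    filter_upwards [hIopen.mem_nhds hs] with x hx
    rw [(hfirst x hx).deriv, hσ x hx]
  have hsecond := (hchain G _ s hs (hG s hs)).congr_of_eventuallyEq hderiv
  refine ⟨(hfirst s hs).differentiableAt, hsecond.differentiableAt, ?_⟩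
  simp only [hsecond.deriv, hσ s hs]
  have := hne (z s)
  field_simp
  ring
end

section
/- Let c(z) = c₀·(1 + ε·(z̄ + e^{−z̄} − 1)) be the Munk sound speed profile, where z̄ = (z − z₀)/W, with c₀ > 0, W > 0, and ε > 0. Then c(z₀) = c₀, c'(z₀) = 0, and the Gaussian curvature K(z) = c(z)·c''(z) − c'(z)² of the Fermat metric evaluated at z = z₀ equals ε·c₀²/W². -/
/-- For the Munk profile
`c(z) = c₀·(1 + ε·(z̄ + e^{−z̄} − 1))` with `z̄ = (z − z₀)/W`, one has
`c(z₀) = c₀`, `c'(z₀) = 0`, and the Gaussian curvature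
`K = c·c'' − (c')²` at `z₀` equals `ε·c₀²/W²`. -/
theorem munk_profile_curvature_at_axis
    (c₀ W ε z₀ : ℝ) (hc₀ : 0 < c₀) (hW : 0 < W) (hε : 0 < ε)
    (c : ℝ → ℝ)
    (hc : ∀ z, c z =
      c₀ * (1 + ε * ((z - z₀) / W + Real.exp (-((z - z₀) / W)) - 1))) :
    c z₀ = c₀ ∧
    deriv c z₀ = 0 ∧
    c z₀ * deriv (deriv c) z₀ - (deriv c z₀) ^ 2 = ε * c₀ ^ 2 / W ^ 2 := by
  have hu : ∀ z, HasDerivAt (fun z => (z - z₀) / W) (1 / W) z := fun z =>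
    ((hasDerivAt_id z).sub_const z₀).div_const W
  have he : ∀ z, HasDerivAt (fun z => Real.exp (-((z - z₀) / W)))
      (Real.exp (-((z - z₀) / W)) * -(1 / W)) z := fun z => (hu z).fun_neg.exp
  have hc' : deriv c = fun z => c₀ * (ε * (1 / W + Real.exp (-((z - z₀) / W)) * -(1 / W))) := by
    funext z
    rw [funext hc]
    exact ((((((hu z).fun_add (he z)).sub_const 1).const_mul ε).const_add 1).const_mul c₀).deriv
  have hc'' : deriv (deriv c) z₀ =
      c₀ * (ε * (Real.exp (-((z₀ - z₀) / W)) * -(1 / W) * -(1 / W))) := by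
    rw [hc']
    exact (((((he z₀).mul_const (-(1 / W))).const_add (1 / W)).const_mul ε).const_mul c₀).deriv
  have h₀ : c z₀ = c₀ := by simp [hc]
  have h₁ : deriv c z₀ = 0 := by simp [hc']
  refine ⟨h₀, h₁, ?_⟩
  rw [h₀, h₁, hc'']
  simp only [sub_self, zero_div, neg_zero, Real.exp_zero]
  field_simp
  ring
end

section
/- Let c : ℝ → ℝ be twice continuously differentiable with c(z) > 0 for all z, and suppose there is a constant K > 0 such that c(z)·c''(z) − c'(z)² = K for every z ∈ ℝ. Then there exist constants c₀ > 0, W > 0, and z₀ ∈ ℝ with K = c₀²/W² such that c(z) = c₀·cosh((z − z₀)/W) for all z. In particular, the hyperbolic cosine profile is the only twice continuously differentiable positive SSP on ℝ whose Fermat metric has constant positive Gaussian curvature. -/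
/-- The quantity `(K + (c')²) / c²` is a first integral of the equation `c·c'' − (c')² = K`. -/
theorem exists_first_integral_of_constant_curvature
    (c d e : ℝ → ℝ) (hcpos : ∀ z, 0 < c z) (hd : ∀ z, HasDerivAt c (d z) z)
    (he : ∀ z, HasDerivAt d (e z) z) (K : ℝ) (hK : 0 < K)
    (hcurv : ∀ z, c z * e z - d z ^ 2 = K) :
    ∃ a : ℝ, 0 < a ∧ ∀ z, K + d z ^ 2 = (a * c z) ^ 2 := by
  have hderiv : ∀ z, HasDerivAt (fun x => (K + d x ^ 2) / c x ^ 2) 0 z := by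
    intro z
    have hz := (hcpos z).ne'
    refine ((((he z).pow 2).const_add K).div ((hd z).pow 2) (pow_ne_zero 2 hz)).congr_deriv ?_
    rw [div_eq_zero_iff]
    left
    simp only [Pi.pow_apply, Nat.cast_ofNat, Nat.add_one_sub_one, pow_one]
    linear_combination 2 * c z * d z * hcurv z
  have hconst : ∀ z, (K + d z ^ 2) / c z ^ 2 = (K + d 0 ^ 2) / c 0 ^ 2 := fun z =>
    is_const_of_deriv_eq_zero (fun x => (hderiv x).differentiableAt)
      (fun x => (hderiv x).deriv) z 0
  have hpos : 0 < (K + d 0 ^ 2) / c 0 ^ 2 := by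
    have := hcpos 0
    positivity
  refine ⟨√((K + d 0 ^ 2) / c 0 ^ 2), Real.sqrt_pos.2 hpos, fun z => ?_⟩
  rw [mul_pow, Real.sq_sqrt hpos.le, ← hconst z, div_mul_cancel₀ _ (pow_ne_zero 2 (hcpos z).ne')]

/-- A positive, twice continuously differentiable SSP on ℝ whose
Fermat metric has constant positive Gaussian curvature
`c·c'' − (c')² = K > 0` must be a hyperbolic cosine profile:
`c(z) = c₀·cosh((z − z₀)/W)` with `K = c₀²/W²`. -/
theorem constant_positive_curvature_is_cosh
    (c : ℝ → ℝ) (hc : ContDiff ℝ 2 c) (hcpos : ∀ z, 0 < c z)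
    (K : ℝ) (hK : 0 < K)
    (hcurv : ∀ z, c z * deriv (deriv c) z - (deriv c z) ^ 2 = K) :
    ∃ c₀ W z₀ : ℝ, 0 < c₀ ∧ 0 < W ∧ K = c₀ ^ 2 / W ^ 2 ∧
      ∀ z, c z = c₀ * Real.cosh ((z - z₀) / W) := by
  have hd : ∀ z, HasDerivAt c (deriv c z) z := fun z =>
    (hc.differentiable (by norm_num) z).hasDerivAt
  have he : ∀ z, HasDerivAt (deriv c) (deriv (deriv c) z) z := fun z =>
    (hc.differentiable_deriv_two z).hasDerivAt
  obtain ⟨a, ha, hE⟩ :=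
    exists_first_integral_of_constant_curvature c _ _ hcpos hd he K hK hcurv
  have hs : 0 < √K := Real.sqrt_pos.2 hK
  have hsq : √K ^ 2 = K := Real.sq_sqrt hK.le
  have hroot : ∀ z, √(1 + (deriv c z / √K) ^ 2) = a * c z / √K := by
    intro z
    have := hcpos z
    rw [Real.sqrt_eq_iff_mul_self_eq (by positivity) (by positivity)]
    field_simp
    rw [hsq, ← mul_pow, hE z]
  have hphase : ∀ z, HasDerivAt (fun x => Real.arsinh (deriv c x / √K) - a * x) 0 z := by
    intro z
    have hz := (hcpos z).ne'
    refine (((he z).div_const √K).arsinh.sub ((hasDerivAt_id z).const_mul a)).congr_deriv ?_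
    rw [hroot z, smul_eq_mul]
    field_simp
    apply mul_left_cancel₀ hz
    linear_combination hE z + hcurv z
  have hlin : ∀ z, Real.arsinh (deriv c z / √K) = a * z + Real.arsinh (deriv c 0 / √K) := by
    intro z
    have h := is_const_of_deriv_eq_zero (fun x => (hphase x).differentiableAt)
      (fun x => (hphase x).deriv) z 0
    simp only [mul_zero, sub_zero] at h
    linarith
  refine ⟨√K / a, a⁻¹, -Real.arsinh (deriv c 0 / √K) / a, by positivity, by positivity, ?_,
    fun z => ?_⟩
  · field_simp
    exact hsq.symm
  · have harg : (z - -Real.arsinh (deriv c 0 / √K) / a) / a⁻¹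
        = Real.arsinh (deriv c z / √K) := by
      rw [hlin z]
      field_simp
      ring
    rw [harg, Real.cosh_arsinh, hroot z]
    field_simp
end

section
/- Let c(z) = c₀·cosh((z − z₀)/W) with c₀ > 0, W > 0, and let (r, z) : I → ℝ² (with 0 ∈ I) be a twice-differentiable curve satisfying the ray equations r̈ = 2(c'(z)/c(z))·ṙ·ż and z̈ = −(c'(z)/c(z))·(ṙ² − ż²) with initial conditions r(0) = 0, z(0) = z₀, ṙ(0) = c₀·cos θ₀, ż(0) = −c₀·sin θ₀. Then for all t ∈ I, cos²θ₀ · cosh²((z(t) − z₀)/W) + sin²θ₀ · cos²(r(t)/W) = 1; equivalently, cosh((z − z₀)/W) = sec θ₀ · (1 − sin²θ₀·cos²(r/W))^{1/2} along the ray. -/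
open Real in
/-- Normalised form: in the coordinates `ρ = r / W`, `u = (z - z₀) / W` the rays are the great
circles of a sphere in Mercator coordinates, so they satisfy a linear relation between
`sinh u` and `sin ρ`. -/
theorem mercator_geodesic_linear_relation {I : Set ℝ} (hI : Convex ℝ I) (h0 : (0 : ℝ) ∈ I)
    {ρ u p q : ℝ → ℝ} {ω θ : ℝ} (hω : 0 < ω)
    (hρ : ∀ t ∈ I, HasDerivAt ρ (p t) t) (hu : ∀ t ∈ I, HasDerivAt u (q t) t)
    (hp : ∀ t ∈ I, HasDerivAt p (2 * (sinh (u t) / cosh (u t)) * p t * q t) t)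
    (hq : ∀ t ∈ I, HasDerivAt q (-(sinh (u t) / cosh (u t)) * (p t ^ 2 - q t ^ 2)) t)
    (hρ0 : ρ 0 = 0) (hu0 : u 0 = 0) (hp0 : p 0 = ω * cos θ) (hq0 : q 0 = -(ω * sin θ)) :
    ∀ t ∈ I, cos θ * sinh (u t) + sin θ * sin (ρ t) = 0 := by
  have const : ∀ f : ℝ → ℝ, (∀ t ∈ I, HasDerivAt f 0 t) → ∀ t ∈ I, f t = f 0 := by
    intro f hf t ht
    have h := hI.norm_image_sub_le_of_norm_hasDerivWithin_le (C := 0)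
      (fun x hx => (hf x hx).hasDerivWithinAt) (by simp) h0 ht
    simpa [sub_eq_zero] using h
  have hC : ∀ t, cosh (u t) ≠ 0 := fun t => (cosh_pos _).ne'
  have hS : ∀ t, sinh (u t) ^ 2 = cosh (u t) ^ 2 - 1 := fun t => sinh_sq _
  have energy : ∀ t ∈ I, p t ^ 2 + q t ^ 2 = ω ^ 2 * cosh (u t) ^ 2 := by
    intro t ht
    have h := const (fun t => (p t ^ 2 + q t ^ 2) / cosh (u t) ^ 2) (fun t ht => by
      have hd := (((hp t ht).pow 2).add ((hq t ht).pow 2)).div ((hu t ht).cosh.pow 2)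
        (pow_ne_zero 2 (hC t))
      refine hd.congr_deriv ?_
      have := hC t
      simp only [Pi.add_apply, Pi.pow_apply, Nat.cast_ofNat]
      field_simp
      ring) t ht
    simp only [hu0, hp0, hq0, cosh_zero] at h
    rw [div_eq_iff (pow_ne_zero 2 (hC t))] at h
    rw [h]
    linear_combination ω ^ 2 * cosh (u t) ^ 2 * sin_sq_add_cos_sq θ
  set g : ℝ → ℝ := fun t => (cos θ * sinh (u t) + sin θ * sin (ρ t)) / cosh (u t) with hg
  set k : ℝ → ℝ := fun t => sin θ * cos (ρ t) * p t / cosh (u t) +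
    (cos θ - sin θ * sin (ρ t) * sinh (u t)) * q t / cosh (u t) ^ 2 with hk
  have hgd : ∀ t ∈ I, HasDerivAt g (k t) t := by
    intro t ht
    have hd := (((hu t ht).sinh.const_mul (cos θ)).add ((hρ t ht).sin.const_mul (sin θ))).div
      (hu t ht).cosh (hC t)
    refine hd.congr_deriv ?_
    have := hC t
    simp only [hk, Pi.add_apply]
    field_simp
    linear_combination (-cos θ * q t) * hS t
  have hkd : ∀ t ∈ I, HasDerivAt k (-(ω ^ 2 * g t)) t := by
    intro t ht
    have hd := ((((hρ t ht).cos.const_mul (sin θ)).mul (hp t ht)).div (hu t ht).cosh (hC t)).add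
      ((((((hρ t ht).sin.const_mul (sin θ)).mul (hu t ht).sinh).const_sub (cos θ)).mul
        (hq t ht)).div ((hu t ht).cosh.pow 2) (pow_ne_zero 2 (hC t)))
    refine hd.congr_deriv ?_
    have := hC t
    have hω2 : ω ^ 2 = (p t ^ 2 + q t ^ 2) / cosh (u t) ^ 2 := by
      rw [energy t ht]; field_simp
    simp only [hg, hω2, Pi.mul_apply, Pi.pow_apply]
    field_simp
    simp
    ring_nf
    simp only [hS]
    ring
  intro t ht
  have h := const (fun t => k t ^ 2 + ω ^ 2 * g t ^ 2) (fun t ht => by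
    have hd := ((hkd t ht).pow 2).add (((hgd t ht).pow 2).const_mul (ω ^ 2))
    refine hd.congr_deriv ?_
    simp
    ring) t ht
  have h1 : k t ^ 2 + ω ^ 2 * g t ^ 2 = 0 := by
    rw [h]
    simp [hk, hg, hρ0, hu0, hp0, hq0]
    ring
  have h2 : g t = 0 := by
    have : ω ^ 2 * g t ^ 2 = 0 := by nlinarith [sq_nonneg (k t), sq_nonneg (ω * g t)]
    simpa [hω.ne'] using this
  simpa [hg, hC t] using h2


/-- For the hyperbolic cosine duct `c(z) = c₀·cosh((z − z₀)/W)`,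
along any ray launched from `(0, z₀)` with elevation angle `θ₀`,
`cos²θ₀·cosh²((z − z₀)/W) + sin²θ₀·cos²(r/W) = 1`. -/
theorem cosh_duct_ray_invariant
    (c₀ W z₀ θ₀ : ℝ) (hc₀ : 0 < c₀) (hW : 0 < W)
    (c : ℝ → ℝ) (hc : ∀ x, c x = c₀ * Real.cosh ((x - z₀) / W))
    (I : Set ℝ) (hI : Convex ℝ I) (h0 : (0 : ℝ) ∈ I)
    (r z : ℝ → ℝ)
    (hr1 : ∀ t ∈ I, DifferentiableAt ℝ r t)
    (hr2 : ∀ t ∈ I, DifferentiableAt ℝ (deriv r) t)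
    (hz1 : ∀ t ∈ I, DifferentiableAt ℝ z t)
    (hz2 : ∀ t ∈ I, DifferentiableAt ℝ (deriv z) t)
    (hrayr : ∀ t ∈ I, deriv (deriv r) t =
      2 * (deriv c (z t) / c (z t)) * deriv r t * deriv z t)
    (hrayz : ∀ t ∈ I, deriv (deriv z) t =
      -(deriv c (z t) / c (z t)) * ((deriv r t) ^ 2 - (deriv z t) ^ 2))
    (hr0 : r 0 = 0) (hz0 : z 0 = z₀)
    (hr'0 : deriv r 0 = c₀ * Real.cos θ₀)
    (hz'0 : deriv z 0 = -(c₀ * Real.sin θ₀)) :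
    ∀ t ∈ I,
      (Real.cos θ₀) ^ 2 * (Real.cosh ((z t - z₀) / W)) ^ 2 +
        (Real.sin θ₀) ^ 2 * (Real.cos (r t / W)) ^ 2 = 1 := by
  have hW' := hW.ne'
  have hlog : ∀ x, deriv c x / c x =
      Real.sinh ((x - z₀) / W) / Real.cosh ((x - z₀) / W) / W := by
    intro x
    have hd : HasDerivAt c (c₀ * (Real.sinh ((x - z₀) / W) * (1 / W))) x := by
      rw [funext hc]
      exact ((((hasDerivAt_id x).sub_const z₀).div_const W).cosh).const_mul c₀
    rw [hd.deriv, hc]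
    have := (Real.cosh_pos ((x - z₀) / W)).ne'
    field_simp
  intro t ht
  have key := mercator_geodesic_linear_relation (ρ := fun t => r t / W)
    (u := fun t => (z t - z₀) / W) (p := fun t => deriv r t / W) (q := fun t => deriv z t / W)
    (ω := c₀ / W) (θ := θ₀) hI h0 (by positivity)
    (fun t ht => (hr1 t ht).hasDerivAt.div_const W)
    (fun t ht => ((hz1 t ht).hasDerivAt.sub_const z₀).div_const W)
    (fun t ht => ((hr2 t ht).hasDerivAt.div_const W).congr_deriv (by
      rw [hrayr t ht, hlog]; ring))
    (fun t ht => ((hz2 t ht).hasDerivAt.div_const W).congr_deriv (by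
      rw [hrayz t ht, hlog]; ring))
    (by simp [hr0]) (by simp [hz0]) (by simp only [hr'0]; ring) (by simp only [hz'0]; ring) t ht
  rw [Real.cosh_sq, Real.cos_sq' (r t / W)]
  linear_combination Real.sin_sq_add_cos_sq θ₀ + (Real.cos θ₀ * Real.sinh ((z t - z₀) / W) -
    Real.sin θ₀ * Real.sin (r t / W)) * key
end

section
/- (Perfect refocusing in the hyperbolic cosine duct.) Let c(z) = c₀·cosh((z − z₀)/W) with c₀ > 0, W > 0, and let θ₀ ∈ (−π/2, π/2). Let (r, z) : [0,∞) → ℝ² be a twice-differentiable curve satisfying the ray equations r̈ = 2(c'(z)/c(z))·ṙ·ż and z̈ = −(c'(z)/c(z))·(ṙ² − ż²) with r(0) = 0, z(0) = z₀, ṙ(0) = c₀·cos θ₀, ż(0) = −c₀·sin θ₀. Then there exists T > 0 such that r(T) = π·W and z(T) = z₀. In particular, the range between successive caustics/focusing points is π·W, independent of the initial elevation angle θ₀. -/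
/-- A function on `[0, ∞)` with vanishing derivative is constant. -/
theorem eq_apply_zero_of_hasDerivAt_zero {f : ℝ → ℝ} (hf : ∀ t, 0 ≤ t → HasDerivAt f 0 t)
    {t : ℝ} (ht : 0 ≤ t) : f t = f 0 :=
  constant_of_has_deriv_right_zero
    (fun x hx => (hf x hx.1).continuousAt.continuousWithinAt)
    (fun x hx => (hf x hx.1).hasDerivWithinAt) t ⟨ht, le_rfl⟩

/-- The logarithmic derivative of a hyperbolic cosine profile. -/
theorem deriv_div_cosh_profile {c₀ W z₀ : ℝ} (hc₀ : 0 < c₀) {c : ℝ → ℝ}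
    (hc : ∀ x, c x = c₀ * Real.cosh ((x - z₀) / W)) (x : ℝ) :
    deriv c x / c x = Real.sinh ((x - z₀) / W) / (W * Real.cosh ((x - z₀) / W)) := by
  have h : HasDerivAt c (c₀ * (Real.sinh ((x - z₀) / W) * (1 / W))) x := by
    rw [funext hc]
    exact ((((hasDerivAt_id x).sub_const z₀).div_const W).cosh).const_mul c₀
  have hcosh := (Real.cosh_pos ((x - z₀) / W)).ne'
  rw [h.deriv, hc]
  field_simp


/-- Perfect refocusing in the hyperbolic cosine duct: For
`c(z) = c₀·cosh((z − z₀)/W)`, any ray launched from `(0, z₀)` with elevation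
angle `θ₀ ∈ (−π/2, π/2)` returns to the axis depth `z₀` at horizontal range
`π·W`: there exists `T > 0` with `r(T) = π·W` and `z(T) = z₀`. -/
theorem cosh_duct_perfect_refocusing
    (c₀ W z₀ θ₀ : ℝ) (hc₀ : 0 < c₀) (hW : 0 < W)
    (hθ : θ₀ ∈ Set.Ioo (-(Real.pi / 2)) (Real.pi / 2))
    (c : ℝ → ℝ) (hc : ∀ x, c x = c₀ * Real.cosh ((x - z₀) / W))
    (r z : ℝ → ℝ)
    (hr1 : ∀ t ∈ Set.Ici (0 : ℝ), DifferentiableAt ℝ r t)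
    (hr2 : ∀ t ∈ Set.Ici (0 : ℝ), DifferentiableAt ℝ (deriv r) t)
    (hz1 : ∀ t ∈ Set.Ici (0 : ℝ), DifferentiableAt ℝ z t)
    (hz2 : ∀ t ∈ Set.Ici (0 : ℝ), DifferentiableAt ℝ (deriv z) t)
    (hrayr : ∀ t ∈ Set.Ici (0 : ℝ), deriv (deriv r) t =
      2 * (deriv c (z t) / c (z t)) * deriv r t * deriv z t)
    (hrayz : ∀ t ∈ Set.Ici (0 : ℝ), deriv (deriv z) t =
      -(deriv c (z t) / c (z t)) * ((deriv r t) ^ 2 - (deriv z t) ^ 2))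
    (hr0 : r 0 = 0) (hz0 : z 0 = z₀)
    (hr'0 : deriv r 0 = c₀ * Real.cos θ₀)
    (hz'0 : deriv z 0 = -(c₀ * Real.sin θ₀)) :
    ∃ T : ℝ, 0 < T ∧ r T = Real.pi * W ∧ z T = z₀ := by
  have hcos : 0 < Real.cos θ₀ := Real.cos_pos_of_mem_Ioo hθ
  have hpos (t : ℝ) := Real.cosh_pos ((z t - z₀) / W)
  have hr (t : ℝ) (ht : 0 ≤ t) : HasDerivAt r (deriv r t) t := (hr1 t ht).hasDerivAt
  have hu (t : ℝ) (ht : 0 ≤ t) :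
      HasDerivAt (fun s => (z s - z₀) / W) (deriv z t / W) t :=
    ((hz1 t ht).hasDerivAt.sub_const z₀).div_const W
  have snell (t : ℝ) (ht : 0 ≤ t) :
      deriv r t = c₀ * Real.cos θ₀ * Real.cosh ((z t - z₀) / W) ^ 2 := by
    have hconst := eq_apply_zero_of_hasDerivAt_zero
      (f := fun t => deriv r t / Real.cosh ((z t - z₀) / W) ^ 2) (fun s hs => by
        have hne := (hpos s).ne'
        refine ((hr2 s hs).hasDerivAt.div ((hu s hs).cosh.pow 2) (pow_ne_zero 2 hne)).congr_deriv ?_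
        rw [hrayr s hs, deriv_div_cosh_profile hc₀ hc]
        field_simp
        simp only [Pi.pow_apply]
        ring) ht
    simp only [hz0, hr'0, sub_self, zero_div, Real.cosh_zero, one_pow, div_one] at hconst
    exact (div_eq_iff (pow_ne_zero 2 (hpos t).ne')).mp hconst
  have invariant (t : ℝ) (ht : 0 ≤ t) :
      c₀ * Real.cos θ₀ * (Real.sinh ((z t - z₀) / W) * Real.cos (r t / W)) -
        deriv z t / Real.cosh ((z t - z₀) / W) * Real.sin (r t / W) = 0 := by
    have hconst := eq_apply_zero_of_hasDerivAt_zero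
      (f := fun t => c₀ * Real.cos θ₀ * (Real.sinh ((z t - z₀) / W) * Real.cos (r t / W)) -
        deriv z t / Real.cosh ((z t - z₀) / W) * Real.sin (r t / W)) (fun s hs => by
        have hne := (hpos s).ne'
        have hφ := (hr s hs).div_const W
        refine ((((hu s hs).sinh.mul hφ.cos).const_mul (c₀ * Real.cos θ₀)).sub
          (((hz2 s hs).hasDerivAt.div (hu s hs).cosh hne).mul hφ.sin)).congr_deriv ?_
        simp only [Pi.div_apply]
        rw [hrayz s hs, deriv_div_cosh_profile hc₀ hc, snell s hs]
        field_simp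
        ring) ht
    simpa [hz0, hr0] using hconst
  have hlower (t : ℝ) (ht : 0 ≤ t) : c₀ * Real.cos θ₀ * t ≤ r t := by
    have hmono : MonotoneOn (fun t => r t - c₀ * Real.cos θ₀ * t) (Set.Ici 0) := by
      have hd (s : ℝ) (hs : 0 ≤ s) := (hr s hs).sub ((hasDerivAt_id s).const_mul (c₀ * Real.cos θ₀))
      refine monotoneOn_of_hasDerivWithinAt_nonneg (convex_Ici 0)
        (fun s hs => (hd s hs).continuousAt.continuousWithinAt)
        (fun s hs => (hd s (interior_subset hs)).hasDerivWithinAt) (fun s hs => ?_)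
      rw [snell s (interior_subset hs)]
      have hone := one_le_pow₀ (n := 2) (Real.one_le_cosh ((z s - z₀) / W))
      nlinarith [mul_pos hc₀ hcos]
    have hle := hmono Set.self_mem_Ici ht ht
    simp only [hr0, mul_zero, sub_zero] at hle
    linarith
  have hk : 0 < c₀ * Real.cos θ₀ := mul_pos hc₀ hcos
  have hπW : 0 < Real.pi * W := mul_pos Real.pi_pos hW
  obtain ⟨T, hT, hrT⟩ : Real.pi * W ∈ r '' Set.Icc 0 (Real.pi * W / (c₀ * Real.cos θ₀)) := by
    have hend : 0 ≤ Real.pi * W / (c₀ * Real.cos θ₀) := (div_pos hπW hk).le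
    refine intermediate_value_Icc hend
      (fun s hs => (hr s hs.1).continuousAt.continuousWithinAt) ⟨hr0.trans_le hπW.le, ?_⟩
    simpa only [mul_div_cancel₀ _ hk.ne'] using hlower _ hend
  refine ⟨T, hT.1.lt_of_ne fun h => ?_, hrT, ?_⟩
  · rw [← h, hr0] at hrT
    exact hπW.ne hrT
  · have hinv := invariant T hT.1
    rw [hrT, mul_div_cancel_right₀ _ hW.ne'] at hinv
    simpa [hc₀.ne', hcos.ne', hW.ne', sub_eq_zero] using hinv
end

section
/- (Snell's law integral solution.) Let c : ℝ → ℝ be positive and twice continuously differentiable, and let (r, z) : [0,T] → ℝ² be a twice-differentiable curve satisfying the ray equations r̈ = 2(c'(z)/c(z))·ṙ·ż and z̈ = −(c'(z)/c(z))·(ṙ² − ż²), with r(0) = 0, z(0) = z₀, ṙ(0) = c(z₀)·cos θ₀, ż(0) = −c(z₀)·sin θ₀, and the natural parameterization ṙ(0)² + ż(0)² = c(z₀)². Set a = cos θ₀/c(z₀) and suppose ż(t) < 0 for all t ∈ [0,T]. Then a·c(z(t)) < 1 on (0,T], z is strictly decreasing, and for every t ∈ [0,T], r(t) = ∫_{z(t)}^{z₀}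 a·c(ζ)/(1 − a²·c(ζ)²)^{1/2} dζ. -/
/-- A function whose derivative vanishes on `[0, T]` keeps its initial value there. -/
lemma eq_initial_of_hasDerivAt_zero {T : ℝ} {g : ℝ → ℝ}
    (hg : ∀ t ∈ Set.Icc (0 : ℝ) T, HasDerivAt g 0 t) :
    ∀ t ∈ Set.Icc (0 : ℝ) T, g t = g 0 :=
  constant_of_has_deriv_right_zero
    (fun t ht => (hg t ht).continuousAt.continuousWithinAt)
    (fun t ht => (hg t (Set.Ico_subset_Icc_self ht)).hasDerivWithinAt)


/-- Snell's law integral solution: Along a naturally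
parameterized ray with Snell invariant `a = cos θ₀/c(z₀)` on which the depth is
strictly decreasing (`ż < 0`), one has `a·c(z(t)) < 1` on `(0,T]`, `z` is
strictly decreasing, and the horizontal range is given by the Snell integral
`r(t) = ∫_{z(t)}^{z₀} a·c(ζ)/(1 − a²·c(ζ)²)^{1/2} dζ`. -/
theorem snell_integral_solution
    (c : ℝ → ℝ) (hcpos : ∀ x, 0 < c x) (hc : ContDiff ℝ 2 c)
    (T z₀ θ₀ a : ℝ) (hT : 0 < T)
    (r z : ℝ → ℝ)
    (hr1 : ∀ t ∈ Set.Icc (0 : ℝ) T, DifferentiableAt ℝ r t)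
    (hr2 : ∀ t ∈ Set.Icc (0 : ℝ) T, DifferentiableAt ℝ (deriv r) t)
    (hz1 : ∀ t ∈ Set.Icc (0 : ℝ) T, DifferentiableAt ℝ z t)
    (hz2 : ∀ t ∈ Set.Icc (0 : ℝ) T, DifferentiableAt ℝ (deriv z) t)
    (hrayr : ∀ t ∈ Set.Icc (0 : ℝ) T, deriv (deriv r) t =
      2 * (deriv c (z t) / c (z t)) * deriv r t * deriv z t)
    (hrayz : ∀ t ∈ Set.Icc (0 : ℝ) T, deriv (deriv z) t =
      -(deriv c (z t) / c (z t)) * ((deriv r t) ^ 2 - (deriv z t) ^ 2))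
    (hr0 : r 0 = 0) (hz0 : z 0 = z₀)
    (hr'0 : deriv r 0 = c z₀ * Real.cos θ₀)
    (hz'0 : deriv z 0 = -(c z₀ * Real.sin θ₀))
    (hnat : (deriv r 0) ^ 2 + (deriv z 0) ^ 2 = (c z₀) ^ 2)
    (ha : a = Real.cos θ₀ / c z₀)
    (hdz : ∀ t ∈ Set.Icc (0 : ℝ) T, deriv z t < 0) :
    (∀ t ∈ Set.Ioc (0 : ℝ) T, a * c (z t) < 1) ∧
    StrictAntiOn z (Set.Icc (0 : ℝ) T) ∧
    (∀ t ∈ Set.Icc (0 : ℝ) T,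
      r t = ∫ ζ in (z t)..z₀, a * c ζ / Real.sqrt (1 - a ^ 2 * (c ζ) ^ 2)) := by
  have hcz : ∀ t ∈ Set.Icc (0 : ℝ) T,
      HasDerivAt (fun s => c (z s)) (deriv c (z t) * deriv z t) t := fun t ht =>
    ((hc.differentiable (by norm_num)) (z t)).hasDerivAt.comp t (hz1 t ht).hasDerivAt
  have hc0 := hcpos z₀
  have snell : ∀ t ∈ Set.Icc (0 : ℝ) T, deriv r t = a * c (z t) ^ 2 := by
    intro t ht
    have hconst := eq_initial_of_hasDerivAt_zero (T := T)
      (g := fun s => deriv r s / c (z s) ^ 2) (fun s hs => by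
        have hpos := hcpos (z s)
        refine ((hr2 s hs).hasDerivAt.fun_div ((hcz s hs).fun_pow 2) (by positivity)).congr_deriv ?_
        rw [hrayr s hs]
        field_simp
        ring) t ht
    have hpos := hcpos (z t)
    simp only [hz0, hr'0] at hconst
    rw [div_eq_iff (by positivity)] at hconst
    rw [hconst, ha]
    field_simp
  have speed : ∀ t ∈ Set.Icc (0 : ℝ) T,
      deriv r t ^ 2 + deriv z t ^ 2 = c (z t) ^ 2 := by
    intro t ht
    have hconst := eq_initial_of_hasDerivAt_zero (T := T)
      (g := fun s => (deriv r s ^ 2 + deriv z s ^ 2) / c (z s) ^ 2) (fun s hs => by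
        have hpos := hcpos (z s)
        refine ((((hr2 s hs).hasDerivAt.fun_pow 2).fun_add
          ((hz2 s hs).hasDerivAt.fun_pow 2)).fun_div
          ((hcz s hs).fun_pow 2) (by positivity)).congr_deriv ?_
        rw [hrayr s hs, hrayz s hs]
        field_simp
        ring) t ht
    have hpos := hcpos (z t)
    simp only [hnat, hz0] at hconst
    rwa [div_self (by positivity), div_eq_one_iff_eq (by positivity)] at hconst
  have depth_sq : ∀ t ∈ Set.Icc (0 : ℝ) T,
      deriv z t ^ 2 = c (z t) ^ 2 * (1 - a ^ 2 * c (z t) ^ 2) := by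
    intro t ht
    have h := speed t ht
    rw [snell t ht] at h
    linear_combination h
  have radicand_pos : ∀ t ∈ Set.Icc (0 : ℝ) T, 0 < 1 - a ^ 2 * c (z t) ^ 2 := by
    intro t ht
    have h : 0 < deriv z t ^ 2 := sq_pos_of_neg (hdz t ht)
    rw [depth_sq t ht] at h
    exact pos_of_mul_pos_right h (sq_nonneg _)
  have depth_deriv : ∀ t ∈ Set.Icc (0 : ℝ) T,
      deriv z t = -(c (z t) * √(1 - a ^ 2 * c (z t) ^ 2)) := by
    intro t ht
    have h : √(deriv z t ^ 2) = c (z t) * √(1 - a ^ 2 * c (z t) ^ 2) := by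
      rw [depth_sq t ht, Real.sqrt_mul (sq_nonneg _), Real.sqrt_sq (hcpos _).le]
    rw [Real.sqrt_sq_eq_abs, abs_of_neg (hdz t ht)] at h
    linarith
  refine ⟨fun t ht => ?_, ?_, fun t ht => ?_⟩
  · have h := radicand_pos t (Set.Ioc_subset_Icc_self ht)
    nlinarith
  · refine strictAntiOn_of_deriv_neg (convex_Icc 0 T)
      (fun t ht => (hz1 t ht).continuousAt.continuousWithinAt) fun t ht => ?_
    exact hdz t (interior_subset ht)
  · have hsub : Set.uIcc 0 t ⊆ Set.Icc 0 T := by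
      rw [Set.uIcc_of_le ht.1]
      exact Set.Icc_subset_Icc_right ht.2
    have hsubst := intervalIntegral.integral_comp_mul_deriv' (a := 0) (b := t) (f := z)
      (f' := deriv z) (g := fun ζ => a * c ζ / √(1 - a ^ 2 * c ζ ^ 2))
      (fun s hs => (hz1 s (hsub hs)).hasDerivAt)
      (fun s hs => (hz2 s (hsub hs)).continuousAt.continuousWithinAt)
      (by
        have hcont := hc.continuous
        refine ContinuousOn.div (by fun_prop) (by fun_prop) ?_
        rintro _ ⟨s, hs, rfl⟩
        exact (Real.sqrt_pos.mpr (radicand_pos s (hsub hs))).ne')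
    have hintegrand : ∀ s ∈ Set.uIcc 0 t,
        ((fun ζ => a * c ζ / √(1 - a ^ 2 * c ζ ^ 2)) ∘ z) s * deriv z s = -deriv r s := by
      intro s hs
      have hsqrt := (Real.sqrt_pos.mpr (radicand_pos s (hsub hs))).ne'
      rw [Function.comp_apply, snell s (hsub hs), depth_deriv s (hsub hs)]
      field_simp
    have hrange : ∫ s in (0 : ℝ)..t, deriv r s = r t - r 0 :=
      intervalIntegral.integral_deriv_eq_sub (fun s hs => hr1 s (hsub hs))
        (ContinuousOn.intervalIntegrable fun s hs =>
          (hr2 s (hsub hs)).continuousAt.continuousWithinAt)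
    rw [intervalIntegral.integral_congr hintegrand, intervalIntegral.integral_neg,
      hrange, hr0, hz0, sub_zero] at hsubst
    rw [intervalIntegral.integral_symm, ← hsubst, neg_neg]
end

section
/- (Derivative of the Snell integral with respect to launch angle.) Let c : ℝ → ℝ be continuous and positive, fix z₀ and z with z < z₀, and for θ₀ ∈ (−π/2, π/2) set a(θ₀) = cos θ₀/c(z₀). Suppose a(θ₀)·c(ζ) < 1 for all ζ between z and z₀. Then the Snell range function R(θ₀) = ∫_{z}^{z₀} a(θ₀)·c(ζ)/(1 − a(θ₀)²·c(ζ)²)^{1/2} dζ is differentiable at θ₀ and dR/dθ₀ = −(sin θ₀/c(z₀))·∫_{z}^{z₀} c(ζ)/(1 − a(θ₀)²·c(ζ)²)^{3/2} dζ. -/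
/-- The derivative of `u / √(1 - u²)` on `(-1, 1)`. -/
theorem hasDerivAt_div_sqrt_one_sub_sq {u : ℝ} (hu : u ^ 2 < 1) :
    HasDerivAt (fun x : ℝ => x / Real.sqrt (1 - x ^ 2))
      (1 / (1 - u ^ 2) ^ ((3 : ℝ) / 2)) u := by
  have hpos : 0 < 1 - u ^ 2 := by linarith
  have hsqrt : 0 < Real.sqrt (1 - u ^ 2) := Real.sqrt_pos.2 hpos
  have hrpow : (1 - u ^ 2) ^ ((3 : ℝ) / 2) = (1 - u ^ 2) * Real.sqrt (1 - u ^ 2) := by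
    rw [show (3 : ℝ) / 2 = 1 + 1 / 2 by norm_num, Real.rpow_add hpos, Real.rpow_one,
      ← Real.sqrt_eq_rpow]
  have hinner : HasDerivAt (fun x : ℝ => 1 - x ^ 2) (-(2 * u)) u := by
    simpa using (hasDerivAt_pow 2 u).const_sub 1
  refine ((hasDerivAt_id u).div (hinner.sqrt hpos.ne') hsqrt.ne').congr_deriv ?_
  have hsq := Real.sq_sqrt hpos.le
  rw [hrpow, id, hsq]
  field_simp
  rw [hsq]
  ring

/-- Differentiation of the Snell integral with respect to the Snell invariant. -/
theorem hasDerivAt_integral_div_sqrt_one_sub_sq_mul_sq {c : ℝ → ℝ} (hcont : Continuous c)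
    {z z₀ a : ℝ} (hz : z ≤ z₀) (ha : ∀ ζ ∈ Set.Icc z z₀, |a| * |c ζ| < 1) :
    HasDerivAt (fun x => ∫ ζ in z..z₀, x * c ζ / Real.sqrt (1 - x ^ 2 * c ζ ^ 2))
      (∫ ζ in z..z₀, c ζ / (1 - a ^ 2 * c ζ ^ 2) ^ ((3 : ℝ) / 2)) a := by
  obtain ⟨ζm, hζm, hmax⟩ := isCompact_Icc.exists_isMaxOn (Set.nonempty_Icc.2 hz)
    hcont.abs.continuousOn
  set M := |c ζm|
  have hM : 0 ≤ M := abs_nonneg _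
  obtain ⟨r, har, hrM⟩ : ∃ r, |a| < r ∧ r * M < 1 := by
    have hlim : Filter.Tendsto (fun r => r * M) (nhdsWithin |a| (Set.Ioi |a|))
        (nhds (|a| * M)) :=
      ((continuous_id.mul continuous_const).tendsto _).mono_left nhdsWithin_le_nhds
    obtain ⟨r, h₁, h₂⟩ := ((hlim.eventually_lt_const (ha ζm hζm)).and
      self_mem_nhdsWithin).exists
    exact ⟨r, h₂, h₁⟩
  have hr : 0 ≤ r := (abs_nonneg a).trans har.le
  have hδ : 0 < 1 - (r * M) ^ 2 := by
    have : 0 ≤ r * M := by positivity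
    nlinarith
  have hlower : ∀ ζ ∈ Set.Icc z z₀, ∀ x ∈ Set.Ioo (-r) r,
      1 - (r * M) ^ 2 ≤ 1 - x ^ 2 * c ζ ^ 2 := by
    intro ζ hζ x hx
    have hle : |x * c ζ| ≤ r * M := by
      rw [abs_mul]
      exact mul_le_mul (abs_lt.2 hx).le (hmax hζ) (abs_nonneg _) hr
    have := sq_le_sq' (abs_le.1 hle).1 (abs_le.1 hle).2
    rw [mul_pow] at this
    linarith
  have haIoo : a ∈ Set.Ioo (-r) r := abs_lt.1 har
  have hsub : Set.uIoc z z₀ ⊆ Set.Icc z z₀ := by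
    rw [Set.uIoc_of_le hz]
    exact Set.Ioc_subset_Icc_self
  have hmeas := hcont.measurable
  refine (intervalIntegral.hasDerivAt_integral_of_dominated_loc_of_deriv_le
    (F := fun x ζ => x * c ζ / Real.sqrt (1 - x ^ 2 * c ζ ^ 2))
    (F' := fun x ζ => c ζ / (1 - x ^ 2 * c ζ ^ 2) ^ ((3 : ℝ) / 2))
    (bound := fun _ => M / (1 - (r * M) ^ 2) ^ ((3 : ℝ) / 2))
    (Ioo_mem_nhds haIoo.1 haIoo.2) (Filter.Eventually.of_forall fun x => ?_) ?_ ?_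
    (Filter.Eventually.of_forall fun ζ hζ x hx => ?_) intervalIntegrable_const
    (Filter.Eventually.of_forall fun ζ hζ x hx => ?_)).2
  · exact Measurable.aestronglyMeasurable (by fun_prop)
  · refine ContinuousOn.intervalIntegrable (ContinuousOn.div (by fun_prop) (by fun_prop) ?_)
    intro ζ hζ
    rw [Set.uIcc_of_le hz] at hζ
    exact (Real.sqrt_pos.2 (hδ.trans_le (hlower ζ hζ a haIoo))).ne'
  · exact Measurable.aestronglyMeasurable (by fun_prop)
  · have hle := hlower ζ (hsub hζ) x hx
    rw [norm_div, Real.norm_eq_abs, Real.norm_of_nonneg (Real.rpow_nonneg (hδ.le.trans hle) _)]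
    exact div_le_div₀ hM (hmax (hsub hζ)) (Real.rpow_pos_of_pos hδ _)
      (Real.rpow_le_rpow hδ.le hle (by norm_num))
  · have hlt : (x * c ζ) ^ 2 < 1 := by
      rw [mul_pow]
      linarith [hlower ζ (hsub hζ) x hx]
    have h := (hasDerivAt_div_sqrt_one_sub_sq hlt).comp x (hasDerivAt_mul_const (c ζ))
    simpa only [Function.comp_def, mul_pow, one_div_mul_eq_div] using h

/-- Derivative of the Snell integral w.r.t. launch angle: With
`a(θ₀) = cos θ₀/c(z₀)` and `a(θ₀)·c(ζ) < 1` for all `ζ` between `z` and `z₀`,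
the Snell range function
`R(θ₀) = ∫_z^{z₀} a(θ₀)·c(ζ)/(1 − a(θ₀)²·c(ζ)²)^{1/2} dζ` is differentiable at
`θ₀` with `dR/dθ₀ = −(sin θ₀/c(z₀))·∫_z^{z₀} c(ζ)/(1 − a(θ₀)²·c(ζ)²)^{3/2} dζ`. -/
theorem snell_integral_angle_derivative
    (c : ℝ → ℝ) (hcont : Continuous c) (hcpos : ∀ x, 0 < c x)
    (z z₀ θ₀ : ℝ) (hz : z < z₀)
    (hθ : θ₀ ∈ Set.Ioo (-(Real.pi / 2)) (Real.pi / 2))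
    (ha : ∀ ζ ∈ Set.Icc z z₀, (Real.cos θ₀ / c z₀) * c ζ < 1)
    (R : ℝ → ℝ)
    (hR : ∀ φ, R φ = ∫ ζ in z..z₀,
      (Real.cos φ / c z₀) * c ζ /
        Real.sqrt (1 - (Real.cos φ / c z₀) ^ 2 * (c ζ) ^ 2)) :
    HasDerivAt R
      (-(Real.sin θ₀ / c z₀) *
        ∫ ζ in z..z₀,
          c ζ / (1 - (Real.cos θ₀ / c z₀) ^ 2 * (c ζ) ^ 2) ^ ((3 : ℝ) / 2))
      θ₀ := by
  rw [funext hR]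
  have hcos : 0 < Real.cos θ₀ := Real.cos_pos_of_mem_Ioo hθ
  have habs : ∀ ζ ∈ Set.Icc z z₀, |Real.cos θ₀ / c z₀| * |c ζ| < 1 := by
    intro ζ hζ
    rw [abs_of_pos (div_pos hcos (hcpos z₀)), abs_of_pos (hcpos ζ)]
    exact ha ζ hζ
  have h := (hasDerivAt_integral_div_sqrt_one_sub_sq_mul_sq hcont hz.le habs).comp θ₀
    ((Real.hasDerivAt_cos θ₀).div_const (c z₀))
  rw [mul_comm, ← neg_div]
  exact h
end

section
/- (Transformation of the paraxial ray system from arclength to travel-time.) Let c : ℝ → ℝ be positive and twice continuously differentiable, and let (r, z) : I → ℝ² be a curve parameterized by arclength s (r'² + z'² = 1) satisfying the Frenet–Serret ray equations r'' = (c'/c)·r'·z', z'' = −(c'/c)·(r')². Suppose δq, δp : I → ℝ satisfy dδq/ds = c·δp and dδp/ds = −(c''·(r')²/c²)·δq. Define travel-time t(s) = ∫₀^s c(z(σ))^{−1} dσ, and the intrinsic variables δq̃ = c^{−1}·δq and δp̃ = c·δp regarded as functions of t. Then d(δq̃)/dt = −c'(z)·(dz/ds)·δq̃ + δp̃ and d(δp̃)/dt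 = −c·c''·(dr/ds)²·δq̃ + c'(z)·(dz/ds)·δp̃, with initial conditions δq̃ = 0 and δp̃ = δθ₀ whenever δq(0) = 0 and δp(0) = c(z(0))^{−1}·δθ₀. -/
/-- On an open convex set, the integral of a function which is continuous there has
a strict derivative equal to the integrand. -/
theorem ContinuousOn.integral_hasStrictDerivAt {f : ℝ → ℝ} {I : Set ℝ}
    (hf : ContinuousOn f I) (hI : IsOpen I) (hconv : Convex ℝ I) {a s : ℝ}
    (ha : a ∈ I) (hs : s ∈ I) :
    HasStrictDerivAt (fun u => ∫ x in a..u, f x) (f s) s :=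
  intervalIntegral.integral_hasStrictDerivAt_right
    (hf.mono (hconv.ordConnected.uIcc_subset ha hs)).intervalIntegrable
    (hf.stronglyMeasurableAtFilter hI s hs) (hf.continuousAt (hI.mem_nhds hs))

/-- Transformation of the paraxial ray system from arclength to
travel-time: With the ray parameterized by arclength satisfying the
Frenet–Serret equations and `δq, δp` satisfying the extrinsic Červený
equations, the intrinsic variables `δq̃ = c⁻¹·δq`, `δp̃ = c·δp`, regarded as
functions of travel-time `t(s) = ∫₀ˢ c(z(σ))⁻¹ dσ` (with inverse `s(t)`),
satisfy `dδq̃/dt = −c'·(dz/ds)·δq̃ + δp̃` and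
`dδp̃/dt = −c·c''·(dr/ds)²·δq̃ + c'·(dz/ds)·δp̃`, with `δq̃ = 0`, `δp̃ = δθ₀`
initially whenever `δq(0) = 0`, `δp(0) = c(z(0))⁻¹·δθ₀`. -/
theorem paraxial_arclength_to_travel_time
    (c : ℝ → ℝ) (hcpos : ∀ x, 0 < c x) (hc : ContDiff ℝ 2 c)
    (I : Set ℝ) (hIopen : IsOpen I) (hIconv : Convex ℝ I) (h0 : (0 : ℝ) ∈ I)
    (r z r' z' : ℝ → ℝ)
    (hr : ∀ s ∈ I, HasDerivAt r (r' s) s)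
    (hz : ∀ s ∈ I, HasDerivAt z (z' s) s)
    (hunit : ∀ s ∈ I, (r' s) ^ 2 + (z' s) ^ 2 = 1)
    (hfsr : ∀ s ∈ I, HasDerivAt r' (deriv c (z s) / c (z s) * r' s * z' s) s)
    (hfsz : ∀ s ∈ I, HasDerivAt z' (-(deriv c (z s) / c (z s)) * (r' s) ^ 2) s)
    (δq δp : ℝ → ℝ)
    (hδq : ∀ s ∈ I, HasDerivAt δq (c (z s) * δp s) s)
    (hδp : ∀ s ∈ I, HasDerivAt δp
      (-(deriv (deriv c) (z s) * (r' s) ^ 2 / (c (z s)) ^ 2) * δq s) s)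
    (τ σ : ℝ → ℝ)
    (hτ : ∀ s, τ s = ∫ x in (0 : ℝ)..s, (c (z x))⁻¹)
    (hσ : ∀ s ∈ I, σ (τ s) = s)
    (δqt δpt : ℝ → ℝ)
    (hδqt : ∀ t, δqt t = (c (z (σ t)))⁻¹ * δq (σ t))
    (hδpt : ∀ t, δpt t = c (z (σ t)) * δp (σ t))
    (δθ₀ : ℝ) :
    (∀ s ∈ I,
      deriv δqt (τ s) = -(deriv c (z s) * z' s) * δqt (τ s) + δpt (τ s) ∧
      deriv δpt (τ s) =
        -(c (z s) * deriv (deriv c) (z s) * (r' s) ^ 2) * δqt (τ s) +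
          deriv c (z s) * z' s * δpt (τ s)) ∧
    (δq 0 = 0 → δp 0 = (c (z 0))⁻¹ * δθ₀ → δqt 0 = 0 ∧ δpt 0 = δθ₀) := by
  have hcz : ∀ s ∈ I, HasDerivAt (fun x => c (z x)) (deriv c (z s) * z' s) s := fun s hs =>
    ((hc.differentiable (by norm_num)) (z s)).hasDerivAt.comp s (hz s hs)
  have hcont : ContinuousOn (fun x => (c (z x))⁻¹) I := fun s hs =>
    ((hcz s hs).continuousAt.inv₀ (hcpos _).ne').continuousWithinAt
  have hτσ : ∀ s ∈ I, HasDerivAt σ (c (z s)) (τ s) := by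
    intro s hs
    have h : HasStrictDerivAt τ (c (z s))⁻¹ s := by
      rw [funext hτ]
      exact hcont.integral_hasStrictDerivAt hIopen hIconv h0 hs
    simpa using (h.to_local_left_inverse (inv_ne_zero (hcpos _).ne')
      (Filter.eventually_of_mem (hIopen.mem_nhds hs) hσ)).hasDerivAt
  refine ⟨fun s hs => ?_, fun hq hp => ?_⟩
  · have hne : c (z s) ≠ 0 := (hcpos _).ne'
    have hcomp : ∀ {f : ℝ → ℝ} {f' : ℝ}, HasDerivAt f f' s →
        deriv (fun t => f (σ t)) (τ s) = f' * c (z s) := fun hf =>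
      (HasDerivAt.comp_of_eq (τ s) hf (hτσ s hs) (hσ s hs).symm).deriv
    rw [hδqt (τ s), hδpt (τ s), funext hδqt, funext hδpt, hσ s hs,
      hcomp (((hcz s hs).fun_inv hne).fun_mul (hδq s hs)),
      hcomp ((hcz s hs).fun_mul (hδp s hs))]
    constructor
    · field_simp
    · field_simp
      ring
  · have hσ0 : σ 0 = 0 := by simpa [hτ] using hσ 0 h0
    simp [hδqt, hδpt, hσ0, hq, hp, (hcpos _).ne']
end
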